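/- (Lemma 2.3.1.) Let f ∈ C_c^∞(GL₂(k); ω) and let U₁, U₂ be compact open subgroups of (k, +). Define f' : GL₂(k) → ℂ by f'(m) = (meas(U₁)·meas(U₂))⁻¹ · ∫_{U₁×U₂} f([[1,x₁],[0,1]]·m·[[1,x₂],[0,1]]) · ψ(x₁ + x₂)⁻¹ dx₁ dx₂. Then f' ∈ C_c^∞(GL₂(k); ω), and there exists κ₀ (depending on U₂) such that for all κ ≥ κ₀ and all admissible triples n = (x21, x31, x32): J_κ(n, f) = J_κ(n, f'). -/

import Mathlib

open Matrix MeasureTheory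

noncomputable section

variable (p : ℕ) [Fact p.Prime]

/-- The general element of the split Lie algebra of type `G₂`, realized as a `7 × 7` matrix. -/
def Xmat (a b x01 x10 x11 x21 x31 x32 y01 y10 y11 y21 y31 y32 : ℚ_[p]) :
    Matrix (Fin 7) (Fin 7) ℚ_[p] :=
  !![a, x01, x32, 0, -x21, y10, 2*x11;
     y01, b, x31, x21, 0, -y11, 2*x10;
     y32, y31, -a-b, -y10, y11, 0, 2*y21;
     0, y21, -x10, -a, -y01, -y32, 2*y11;
     -y21, 0, x11, -x01, -b, -y31, 2*y10;
     x10, -x11, 0, -x32, -x31, a+b, 2*x21;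
     y11, y10, x21, x11, x10, y21, 0]

/-- The exponential of a `7 × 7` matrix as a finite sum; for a nilpotent matrix this is the
genuine exponential, since `A ^ 7 = 0`. -/
def mexp (A : Matrix (Fin 7) (Fin 7) ℚ_[p]) : Matrix (Fin 7) (Fin 7) ℚ_[p] :=
  ∑ i ∈ Finset.range 7, (Nat.factorial i : ℚ_[p])⁻¹ • A ^ i

/-- `Ē(y10, y11, y21, y31, y32)`: the exponential of the nilpotent element of `G₂` with lower
coordinates `y10, y11, y21, y31, y32` (and `y01 = 0`). -/
def Ebar (y10 y11 y21 y31 y32 : ℚ_[p]) : Matrix (Fin 7) (Fin 7) ℚ_[p] :=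
  mexp p (Xmat p 0 0 0 0 0 0 0 0 0 y10 y11 y21 y31 y32)

/-- The compact open subset `N̄_κ ⊂ N̄`: the set of `Ē(y10,y11,y21,y31,y32)` with
`v(y10) ≥ -κ²`, `v(y11) ≥ -κ`, `v(y21) ≥ -κ³`, `v(y31) ≥ -κ⁵`, `v(y32) ≥ -κ⁴`. -/
def NbarK (κ : ℕ) : Set (Matrix (Fin 7) (Fin 7) ℚ_[p]) :=
  {M | ∃ y10 y11 y21 y31 y32 : ℚ_[p],
    ‖y10‖ ≤ (p : ℝ)^(κ^2) ∧ ‖y11‖ ≤ (p : ℝ)^κ ∧ ‖y21‖ ≤ (p : ℝ)^(κ^3) ∧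
    ‖y31‖ ≤ (p : ℝ)^(κ^5) ∧ ‖y32‖ ≤ (p : ℝ)^(κ^4) ∧
    M = Ebar p y10 y11 y21 y31 y32}

/-- `φ_κ`, the characteristic function of `N̄_κ`, with values in `ℂ`. -/
def phiK (κ : ℕ) (M : Matrix (Fin 7) (Fin 7) ℚ_[p]) : ℂ :=
  letI := Classical.dec (M ∈ NbarK p κ)
  if M ∈ NbarK p κ then 1 else 0

/-- The embedding `GL₂ ↪ GL₇` realizing `GL₂` as the Levi subgroup `M ⊂ G₂`:
`A ↦ block-diag(A, (det A)⁻¹, ᵗA⁻¹, det A, 1)`. -/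
def iotaM (A : Matrix (Fin 2) (Fin 2) ℚ_[p]) : Matrix (Fin 7) (Fin 7) ℚ_[p] :=
  let a := A 0 0; let b := A 0 1; let c := A 1 0; let d := A 1 1
  let Δ := a*d - b*c
  !![a, b, 0, 0, 0, 0, 0;
     c, d, 0, 0, 0, 0, 0;
     0, 0, Δ⁻¹, 0, 0, 0, 0;
     0, 0, 0, Δ⁻¹*d, -(Δ⁻¹*c), 0, 0;
     0, 0, 0, -(Δ⁻¹*b), Δ⁻¹*a, 0, 0;
     0, 0, 0, 0, 0, Δ, 0;
     0, 0, 0, 0, 0, 0, 1]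

/-- The unipotent element `[[1, x], [0, 1]]` of `GL₂(ℚ_p)`. -/
def uu (x : ℚ_[p]) : GL (Fin 2) ℚ_[p] :=
  Matrix.GeneralLinearGroup.mkOfDetNeZero !![1, x; 0, 1] (by
    rw [Matrix.det_fin_two_of]; norm_num)

/-- The scalar (central) element `t·I₂` of `GL₂(ℚ_p)`, for `t ∈ ℚ_p^×`. -/
def scalGL (t : ℚ_[p]ˣ) : GL (Fin 2) ℚ_[p] :=
  Units.map (Matrix.scalar (Fin 2)).toMonoidHom t

/-- `f ∈ C_c^∞(GL₂(ℚ_p); ω)`: `f` is locally constant, transforms under the center by the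
character `ω`, and is compactly supported modulo the center. -/
def SmoothCptModZ (ω : ℚ_[p]ˣ → ℂ) (f : GL (Fin 2) ℚ_[p] → ℂ) : Prop :=
  IsLocallyConstant f ∧
  (∀ t : ℚ_[p]ˣ, ∀ g, f (scalGL p t * g) = ω t * f g) ∧
  ∃ C : Set (GL (Fin 2) ℚ_[p]), IsCompact C ∧
    ∀ g, f g ≠ 0 → ∃ t : ℚ_[p]ˣ, ∃ c ∈ C, g = scalGL p t * c

variable [MeasurableSpace ℚ_[p]]

/-- The Whittaker-type integral `W^f(m) = ∫_{U_M} f(x·m) ψ(x)⁻¹ dx`. -/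
def Wf (μ : Measure ℚ_[p]) (ψ : ℚ_[p] → ℂ) (f : GL (Fin 2) ℚ_[p] → ℂ)
    (m : GL (Fin 2) ℚ_[p]) : ℂ :=
  ∫ x, f (uu p x * m) * (ψ x)⁻¹ ∂μ

/-- `(x21, x31, x32)` is *admissible* if `x21 ≠ 0`, `x32 ≠ 0`, `D = x21² + x32 ≠ 0` and,
for the resulting `y`-coordinates, the Levi component `m = [[a,b],[c,d]]` has `c ≠ 0` and
`ad - bc ≠ 0`. -/
def y10v (n : ℚ_[p] × ℚ_[p] × ℚ_[p]) : ℚ_[p] := -n.2.2 / (n.1^2 + n.2.2)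
def y11v (n : ℚ_[p] × ℚ_[p] × ℚ_[p]) : ℚ_[p] := (-n.2.1 + (1/2)*n.1) / (n.1^2 + n.2.2)
def y21v (n : ℚ_[p] × ℚ_[p] × ℚ_[p]) : ℚ_[p] := -n.1 / (n.1^2 + n.2.2)
def y31v (n : ℚ_[p] × ℚ_[p] × ℚ_[p]) : ℚ_[p] := ((1/2)*n.2.2*n.1) / (n.1^2 + n.2.2)^2
def y32v (n : ℚ_[p] × ℚ_[p] × ℚ_[p]) : ℚ_[p] :=
  ((3/4)*n.1^2 + n.2.2 + (1/2)*n.1*n.2.1) / (n.1^2 + n.2.2)^2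
def av (n : ℚ_[p] × ℚ_[p] × ℚ_[p]) : ℚ_[p] := y10v p n * y11v p n + y21v p n
def bv (n : ℚ_[p] × ℚ_[p] × ℚ_[p]) : ℚ_[p] := (y10v p n)^2
def cv (n : ℚ_[p] × ℚ_[p] × ℚ_[p]) : ℚ_[p] :=
  -(y11v p n)^2 + (1/2)*y11v p n*y21v p n - y32v p n
def dv (n : ℚ_[p] × ℚ_[p] × ℚ_[p]) : ℚ_[p] :=
  -(1/2)*y10v p n*y11v p n + y21v p n - y31v p n

/-- Admissibility of a triple `(x21, x31, x32)`. -/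
def Adm (n : ℚ_[p] × ℚ_[p] × ℚ_[p]) : Prop :=
  n.1 ≠ 0 ∧ n.2.2 ≠ 0 ∧ n.1^2 + n.2.2 ≠ 0 ∧ cv p n ≠ 0 ∧
    av p n * dv p n - bv p n * cv p n ≠ 0

/-- The Levi component `m(n) = [[a,b],[c,d]] ∈ GL₂(ℚ_p)` of an admissible triple. -/
def mGL (n : ℚ_[p] × ℚ_[p] × ℚ_[p]) (h : Adm p n) : GL (Fin 2) ℚ_[p] :=
  Matrix.GeneralLinearGroup.mkOfDetNeZero !![av p n, bv p n; cv p n, dv p n] (by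
    rw [Matrix.det_fin_two_of]; exact h.2.2.2.2)

/-- `n̄(n) ∈ GL₇(ℚ_p)`, the opposite-unipotent component of the decomposition
`ẇ₀⁻¹·E(1,0,x21,x31,x32) = m(n)·n'·n̄(n)`. -/
def nbarM (n : ℚ_[p] × ℚ_[p] × ℚ_[p]) : Matrix (Fin 7) (Fin 7) ℚ_[p] :=
  Ebar p (y10v p n) (y11v p n) (y21v p n) (y31v p n) (y32v p n)

/-- The partial Bessel function
`J_κ(n, f) = ∫_{U_M} W^f(m(n)·u) φ_κ(u·n̄(n)·u⁻¹) ψ(u)⁻¹ du`, the conjugation being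
computed in `GL₇(ℚ_p)` via the embedding `ι`. -/
def Jk (μ : Measure ℚ_[p]) (ψ : ℚ_[p] → ℂ) (κ : ℕ)
    (n : ℚ_[p] × ℚ_[p] × ℚ_[p]) (h : Adm p n) (f : GL (Fin 2) ℚ_[p] → ℂ) : ℂ :=
  ∫ x, Wf p μ ψ f (mGL p n h * uu p x) *
    phiK p κ (iotaM p (uu p x).val * nbarM p n * (iotaM p (uu p x).val)⁻¹) *
    (ψ x)⁻¹ ∂μ

section UnipotentAction

variable (q : ℕ) [Fact q.Prime]

theorem uu_add (x y : ℚ_[q]) : uu q (x + y) = uu q x * uu q y := by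
  ext i j
  fin_cases i <;> fin_cases j <;>
    simp [uu, Matrix.GeneralLinearGroup.mkOfDetNeZero, Matrix.mul_apply, Fin.sum_univ_two, add_comm]

theorem uu_zero : uu q 0 = 1 := by
  ext i j
  fin_cases i <;> fin_cases j <;> simp [uu, Matrix.GeneralLinearGroup.mkOfDetNeZero]

theorem uu_neg (x : ℚ_[q]) : uu q (-x) = (uu q x)⁻¹ := by
  rw [eq_inv_iff_mul_eq_one, ← uu_add, neg_add_cancel, uu_zero]

theorem continuous_uu : Continuous (uu q) := by
  have h : Continuous fun x : ℚ_[q] => ((uu q x : GL (Fin 2) ℚ_[q]) : Matrix (Fin 2) (Fin 2) ℚ_[q]) := by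
    refine continuous_matrix fun i j => ?_
    fin_cases i <;> fin_cases j <;>
      simp [uu, Matrix.GeneralLinearGroup.mkOfDetNeZero] <;> fun_prop
  refine Units.continuous_iff.2 ⟨h, ?_⟩
  have h' := h.comp (continuous_neg (G := ℚ_[q]))
  refine h'.congr fun x => ?_
  simp [uu_neg]

theorem scalGL_mul_comm (t : ℚ_[q]ˣ) (g : GL (Fin 2) ℚ_[q]) : scalGL q t * g = g * scalGL q t := by
  ext i j
  simp [scalGL, mul_comm]

theorem iotaM_uu_apply (x : ℚ_[q]) :
    iotaM q (uu q x).val =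
      !![1, x, 0, 0, 0, 0, 0;
         0, 1, 0, 0, 0, 0, 0;
         0, 0, 1, 0, 0, 0, 0;
         0, 0, 0, 1, 0, 0, 0;
         0, 0, 0, -x, 1, 0, 0;
         0, 0, 0, 0, 0, 1, 0;
         0, 0, 0, 0, 0, 0, 1] := by
  simp [iotaM, uu, Matrix.GeneralLinearGroup.mkOfDetNeZero]

theorem iotaM_uu_add (x y : ℚ_[q]) :
    iotaM q (uu q (x + y)).val = iotaM q (uu q x).val * iotaM q (uu q y).val := by
  simp only [iotaM_uu_apply]
  ext i j
  fin_cases i <;> fin_cases j <;>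
    simp [Matrix.mul_apply, Fin.sum_univ_succ, add_comm]

theorem iotaM_uu_zero : iotaM q (uu q 0).val = 1 := by
  rw [iotaM_uu_apply]
  ext i j
  fin_cases i <;> fin_cases j <;> simp

theorem iotaM_uu_neg (x : ℚ_[q]) : iotaM q (uu q (-x)).val = (iotaM q (uu q x).val)⁻¹ :=
  (Matrix.inv_eq_left_inv (by rw [← iotaM_uu_add, neg_add_cancel, iotaM_uu_zero])).symm

theorem iotaM_uu_mul_Xmat (x y10 y11 y21 y31 y32 : ℚ_[q]) :
    iotaM q (uu q x).val * Xmat q 0 0 0 0 0 0 0 0 0 y10 y11 y21 y31 y32 =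
      Xmat q 0 0 0 0 0 0 0 0 0 (y10 - x * y11) y11 y21 (y31 - x * y32) y32 *
        iotaM q (uu q x).val := by
  simp only [iotaM_uu_apply, Xmat]
  ext i j
  fin_cases i <;> fin_cases j <;>
    simp [Matrix.mul_apply, Fin.sum_univ_succ] <;> ring

theorem conj_mexp {U V A : Matrix (Fin 7) (Fin 7) ℚ_[q]} (h : V * U = 1) :
    U * mexp q A * V = mexp q (U * A * V) := by
  have h' : U * V = 1 := mul_eq_one_comm.1 h
  let u : (Matrix (Fin 7) (Fin 7) ℚ_[q])ˣ := ⟨U, V, h', h⟩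
  have hpow (i : ℕ) : U * A ^ i * V = (U * A * V) ^ i := (Units.conj_pow u A i).symm
  simp only [mexp, Finset.mul_sum, Finset.sum_mul, ← hpow, Matrix.mul_smul, Matrix.smul_mul]

theorem conj_Ebar (x y10 y11 y21 y31 y32 : ℚ_[q]) :
    iotaM q (uu q x).val * Ebar q y10 y11 y21 y31 y32 * (iotaM q (uu q x).val)⁻¹ =
      Ebar q (y10 - x * y11) y11 y21 (y31 - x * y32) y32 := by
  rw [← iotaM_uu_neg, Ebar, conj_mexp q (by rw [← iotaM_uu_add, neg_add_cancel, iotaM_uu_zero]),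
    iotaM_uu_mul_Xmat, Matrix.mul_assoc, ← iotaM_uu_add, add_neg_cancel, iotaM_uu_zero,
    Matrix.mul_one, Ebar]

theorem conj_mem_NbarK {κ : ℕ} (hκ : 2 ≤ κ) {x : ℚ_[q]} (hx : ‖x‖ ≤ (q : ℝ) ^ κ)
    {M : Matrix (Fin 7) (Fin 7) ℚ_[q]} (hM : M ∈ NbarK q κ) :
    iotaM q (uu q x).val * M * (iotaM q (uu q x).val)⁻¹ ∈ NbarK q κ := by
  obtain ⟨y10, y11, y21, y31, y32, h10, h11, h21, h31, h32, rfl⟩ := hM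
  have hp : (1 : ℝ) ≤ q := by exact_mod_cast (Fact.out : q.Prime).one_lt.le
  have key {a b : ℚ_[q]} {r s : ℕ} (ha : ‖a‖ ≤ (q : ℝ) ^ r) (hb : ‖b‖ ≤ (q : ℝ) ^ s)
      (hrs : κ + s ≤ r) : ‖a - x * b‖ ≤ (q : ℝ) ^ r := by
    rw [sub_eq_add_neg]
    refine (Padic.nonarchimedean _ _).trans (max_le ha ?_)
    rw [norm_neg]
    calc ‖x * b‖ = ‖x‖ * ‖b‖ := norm_mul _ _
      _ ≤ (q : ℝ) ^ κ * (q : ℝ) ^ s := by gcongr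
      _ = (q : ℝ) ^ (κ + s) := (pow_add _ _ _).symm
      _ ≤ (q : ℝ) ^ r := pow_le_pow_right₀ hp hrs
  refine ⟨y10 - x * y11, y11, y21, y31 - x * y32, y32, key h10 h11 ?_, h11, h21,
    key h31 h32 ?_, h32, conj_Ebar q ..⟩
  · nlinarith
  · have h1 : κ ≤ κ ^ 4 := Nat.le_self_pow (by norm_num) κ
    have h2 : 2 * κ ^ 4 ≤ κ ^ 5 := by rw [pow_succ κ 4, mul_comm]; gcongr
    omega

theorem phiK_congr {κ : ℕ} {M N : Matrix (Fin 7) (Fin 7) ℚ_[q]}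
    (h : M ∈ NbarK q κ ↔ N ∈ NbarK q κ) : phiK q κ M = phiK q κ N := by
  by_cases hN : N ∈ NbarK q κ <;> simp [phiK, h, hN]

/-- The weight `x ↦ φ_κ(u(x) n̄ u(x)⁻¹)` is invariant under translation by elements of norm at
most `q ^ κ`. -/
theorem phiK_conj_add {κ : ℕ} (hκ : 2 ≤ κ) {t : ℚ_[q]} (ht : ‖t‖ ≤ (q : ℝ) ^ κ) (x : ℚ_[q])
    (N : Matrix (Fin 7) (Fin 7) ℚ_[q]) :
    phiK q κ (iotaM q (uu q (x + t)).val * N * (iotaM q (uu q (x + t)).val)⁻¹) =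
      phiK q κ (iotaM q (uu q x).val * N * (iotaM q (uu q x).val)⁻¹) := by
  have step (s y : ℚ_[q]) (hs : ‖s‖ ≤ (q : ℝ) ^ κ)
      (h : iotaM q (uu q y).val * N * (iotaM q (uu q y).val)⁻¹ ∈ NbarK q κ) :
      iotaM q (uu q (s + y)).val * N * (iotaM q (uu q (s + y)).val)⁻¹ ∈ NbarK q κ := by
    have := conj_mem_NbarK q hκ hs h
    simpa only [iotaM_uu_add, Matrix.mul_inv_rev, Matrix.mul_assoc] using this
  have : iotaM q (uu q (x + t)).val * N * (iotaM q (uu q (x + t)).val)⁻¹ ∈ NbarK q κ ↔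
      iotaM q (uu q x).val * N * (iotaM q (uu q x).val)⁻¹ ∈ NbarK q κ := by
    refine ⟨fun h => ?_, fun h => ?_⟩
    · simpa using step (-t) (x + t) (by rwa [norm_neg]) h
    · simpa [add_comm] using step t x ht h
  exact phiK_congr q this

/-- Sections of `f ∈ C_c^∞(GL₂; ω)` over a double coset `U_M m U_M` have bounded support when
`m` lies in the big cell. -/
theorem SmoothCptModZ.bounded_section {ω : ℚ_[q]ˣ → ℂ} {f : GL (Fin 2) ℚ_[q] → ℂ}
    (hf : SmoothCptModZ q ω f) (m : GL (Fin 2) ℚ_[q]) (hm : m.val 1 0 ≠ 0) :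
    ∃ R : ℝ, ∀ y x, f (uu q y * m * uu q x) ≠ 0 → ‖y‖ ≤ R ∧ ‖x‖ ≤ R := by
  obtain ⟨-, -, C, hC, hsupp⟩ := hf
  have hdet : Continuous fun c : GL (Fin 2) ℚ_[q] => (c⁻¹).val.det :=
    (Units.continuous_val.comp continuous_inv).matrix_det
  obtain ⟨B, hB⟩ := hC.exists_bound_of_continuousOn hdet.continuousOn
  have hval (i j : Fin 2) : Continuous fun c : GL (Fin 2) ℚ_[q] => c.val i j :=
    Units.continuous_val.matrix_elem i j
  obtain ⟨B₀, hB₀⟩ := hC.exists_bound_of_continuousOn (hval 0 0).continuousOn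
  obtain ⟨B₁, hB₁⟩ := hC.exists_bound_of_continuousOn (hval 1 1).continuousOn
  set T := √(‖m.val.det‖ * B)
  set c := m.val 1 0
  have hc : 0 < ‖c‖ := norm_pos_iff.2 hm
  refine ⟨max ((T * B₀ + ‖m.val 0 0‖) / ‖c‖) ((T * B₁ + ‖m.val 1 1‖) / ‖c‖), fun y x h => ?_⟩
  obtain ⟨t, k, hk, hg⟩ := hsupp _ h
  have hg' : (uu q y * m * uu q x).val = (t : ℚ_[q]) • k.val := by
    rw [hg]; ext i j; simp [scalGL]
  have e00 : m.val 0 0 + y * c = t * k.val 0 0 := by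
    have := congrFun (congrFun hg' 0) 0
    simpa [uu, Matrix.GeneralLinearGroup.mkOfDetNeZero, Matrix.mul_apply, Matrix.vecMul,
      dotProduct, Fin.sum_univ_two] using this
  have e11 : c * x + m.val 1 1 = t * k.val 1 1 := by
    have := congrFun (congrFun hg' 1) 1
    simpa [uu, Matrix.GeneralLinearGroup.mkOfDetNeZero, Matrix.mul_apply, Matrix.vecMul,
      dotProduct, Fin.sum_univ_two] using this
  have ht : ‖(t : ℚ_[q])‖ ≤ T := by
    have e := congrArg Matrix.det hg'
    have hu (z : ℚ_[q]) : (uu q z).val.det = 1 := by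
      simp [uu, Matrix.GeneralLinearGroup.mkOfDetNeZero]
    simp only [Units.val_mul, Matrix.det_mul, hu, one_mul, mul_one, Matrix.det_smul,
      Fintype.card_fin] at e
    have hk' : k.val.det * (k⁻¹).val.det = 1 := by
      rw [← Matrix.det_mul, ← Units.val_mul, mul_inv_cancel, Units.val_one, Matrix.det_one]
    refine Real.le_sqrt_of_sq_le ?_
    calc ‖(t : ℚ_[q])‖ ^ 2 = ‖m.val.det * (k⁻¹).val.det‖ := by
          rw [e, mul_assoc, hk', mul_one, norm_pow]
      _ ≤ ‖m.val.det‖ * B := by rw [norm_mul]; gcongr; exact hB k hk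
  have hT : 0 ≤ T := Real.sqrt_nonneg _
  refine ⟨le_max_of_le_left ?_, le_max_of_le_right ?_⟩
  · rw [le_div_iff₀ hc, ← norm_mul, eq_sub_of_add_eq' e00]
    refine (norm_sub_le _ _).trans ?_
    rw [norm_mul]
    gcongr
    exact hB₀ k hk
  · rw [le_div_iff₀ hc, mul_comm, ← norm_mul, eq_sub_of_add_eq e11]
    refine (norm_sub_le _ _).trans ?_
    rw [norm_mul]
    gcongr
    exact hB₁ k hk

variable [MeasurableSpace ℚ_[q]]

theorem SmoothCptModZ.smoothing (μ : Measure ℚ_[q]) (χ : ℚ_[q] → ℚ_[q] → ℂ) (a : ℂ)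
    {ω : ℚ_[q]ˣ → ℂ} {f : GL (Fin 2) ℚ_[q] → ℂ} (hf : SmoothCptModZ q ω f) {K₁ K₂ : Set ℚ_[q]}
    (hK₁ : IsCompact K₁) (hK₂ : IsCompact K₂) (hm₁ : MeasurableSet K₁) (hm₂ : MeasurableSet K₂) :
    SmoothCptModZ q ω fun m =>
      a * ∫ x₁ in K₁, ∫ x₂ in K₂, f (uu q x₁ * m * uu q x₂) * χ x₁ x₂ ∂μ ∂μ := by
  obtain ⟨hlc, hω, C, hC, hsupp⟩ := hf
  have hu := continuous_uu q
  refine ⟨(IsLocallyConstant.iff_eventually_eq _).2 fun m₀ => ?_, fun t g => ?_, ?_⟩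
  · have hF : IsLocallyConstant fun z : GL (Fin 2) ℚ_[q] × ℚ_[q] × ℚ_[q] =>
        f (uu q z.2.1 * z.1 * uu q z.2.2) :=
      hlc.comp_continuous (f := fun z : GL (Fin 2) ℚ_[q] × ℚ_[q] × ℚ_[q] =>
        uu q z.2.1 * z.1 * uu q z.2.2) (by fun_prop)
    have hG : IsLocallyConstant fun w : ℚ_[q] × ℚ_[q] => f (uu q w.1 * m₀ * uu q w.2) :=
      hlc.comp_continuous (f := fun w : ℚ_[q] × ℚ_[q] => uu q w.1 * m₀ * uu q w.2) (by fun_prop)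
    have key := (hK₁.prod hK₂).eventually_forall_of_forall_eventually (x₀ := m₀)
      (P := fun m w => f (uu q w.1 * m * uu q w.2) = f (uu q w.1 * m₀ * uu q w.2))
      (fun w _ => by
        filter_upwards [(IsLocallyConstant.iff_eventually_eq _).1 hF (m₀, w),
          continuous_snd.continuousAt.eventually
            ((IsLocallyConstant.iff_eventually_eq _).1 hG w)] with z h1 h2
        exact h1.trans h2.symm)
    filter_upwards [key] with m hm
    congr 1
    refine setIntegral_congr_fun hm₁ fun x₁ h₁ => setIntegral_congr_fun hm₂ fun x₂ h₂ => ?_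
    exact congrArg (· * _) (hm (x₁, x₂) ⟨h₁, h₂⟩)
  · have h (x₁ x₂ : ℚ_[q]) : f (uu q x₁ * (scalGL q t * g) * uu q x₂) =
        ω t * f (uu q x₁ * g * uu q x₂) := by
      rw [← hω, ← mul_assoc (uu q x₁), ← scalGL_mul_comm]
      simp only [mul_assoc]
    simp only [h, mul_assoc (ω t), integral_const_mul]
    ring
  · refine ⟨(fun z : (ℚ_[q] × ℚ_[q]) × GL (Fin 2) ℚ_[q] =>
      (uu q z.1.1)⁻¹ * z.2 * (uu q z.1.2)⁻¹) '' ((K₁ ×ˢ K₂) ×ˢ C),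
      ((hK₁.prod hK₂).prod hC).image (by fun_prop), fun g hg => ?_⟩
    obtain ⟨x₁, h₁, x₂, h₂, h⟩ : ∃ x₁ ∈ K₁, ∃ x₂ ∈ K₂, f (uu q x₁ * g * uu q x₂) ≠ 0 := by
      contrapose! hg
      rw [setIntegral_eq_zero_of_forall_eq_zero, mul_zero]
      intro x₁ h₁
      refine setIntegral_eq_zero_of_forall_eq_zero fun x₂ h₂ => ?_
      rw [hg x₁ h₁ x₂ h₂, zero_mul]
    obtain ⟨t, c, hc, e⟩ := hsupp _ h
    refine ⟨t, _, ⟨((x₁, x₂), c), ⟨⟨h₁, h₂⟩, hc⟩, rfl⟩, ?_⟩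
    have : g = (uu q x₁)⁻¹ * (scalGL q t * c) * (uu q x₂)⁻¹ := by rw [← e]; group
    rw [this, ← mul_assoc (uu q x₁)⁻¹, ← scalGL_mul_comm]
    simp only [mul_assoc]

end UnipotentAction

/-- Averaging over translations by a set of finite positive measure preserves the integral of a
compactly supported continuous function of two variables. -/
theorem integral_average_translate {G : Type*} [TopologicalSpace G] [AddCommGroup G]
    [IsTopologicalAddGroup G] [SecondCountableTopology G] [LocallyCompactSpace G]
    [MeasurableSpace G] [BorelSpace G] (μ : Measure G) [μ.IsAddHaarMeasure] [SFinite μ]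
    {H : G → G → ℂ} (hH : Continuous H.uncurry) (hHc : HasCompactSupport H.uncurry)
    {K₁ K₂ : Set G} (hK₁ : IsCompact K₁) (hK₂ : IsCompact K₂)
    (hK₁0 : μ K₁ ≠ 0) (hK₂0 : μ K₂ ≠ 0) :
    ∫ x, ∫ y, H y x ∂μ ∂μ =
      (((μ K₁).toReal : ℂ) * ((μ K₂).toReal : ℂ))⁻¹ *
        ∫ x, ∫ y, ∫ x₁ in K₁, ∫ x₂ in K₂, H (y + x₁) (x + x₂) ∂μ ∂μ ∂μ ∂μ := by
  have hI : Integrable H.uncurry (μ.prod μ) := hH.integrable_of_hasCompactSupport hHc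
  set ν := (μ.restrict K₁).prod (μ.restrict K₂) with hν
  have : IsFiniteMeasure (μ.restrict K₁) := isFiniteMeasure_restrict.2 hK₁.measure_ne_top
  have : IsFiniteMeasure (μ.restrict K₂) := isFiniteMeasure_restrict.2 hK₂.measure_ne_top
  have htrans : Integrable (fun r : (G × G) × (G × G) => H.uncurry (r.1 + r.2))
      ((μ.prod μ).prod ν) := by
    have hc : Continuous fun r : (G × G) × (G × G) => H.uncurry (r.1 + r.2) :=
      hH.comp (continuous_fst.add continuous_snd)
    refine (integrable_prod_iff' hc.aestronglyMeasurable).2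
      ⟨.of_forall fun w => hI.comp_add_right w, ?_⟩
    have (w : G × G) : ∫ z, ‖H.uncurry (z + w)‖ ∂(μ.prod μ) = ∫ z, ‖H.uncurry z‖ ∂(μ.prod μ) :=
      integral_add_right_eq_self (fun z => ‖H.uncurry z‖) w
    simp only [this]
    exact integrable_const _
  have hinner (x y : G) : ∫ x₁ in K₁, ∫ x₂ in K₂, H (y + x₁) (x + x₂) ∂μ ∂μ =
      ∫ w, H.uncurry ((y, x) + w) ∂ν := by
    refine (integral_prod (fun w : G × G => H.uncurry ((y, x) + w)) ?_).symm
    rw [Measure.prod_restrict]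
    exact (hI.comp_add_left (y, x)).restrict
  have hmass : ν.real Set.univ = (μ K₁).toReal * (μ K₂).toReal := by
    simp [hν, Measure.real, ← Set.univ_prod_univ, Measure.prod_prod]
  have h₁ : ((μ K₁).toReal : ℂ) ≠ 0 :=
    Complex.ofReal_ne_zero.2 (ENNReal.toReal_ne_zero.2 ⟨hK₁0, hK₁.measure_ne_top⟩)
  have h₂ : ((μ K₂).toReal : ℂ) ≠ 0 :=
    Complex.ofReal_ne_zero.2 (ENNReal.toReal_ne_zero.2 ⟨hK₂0, hK₂.measure_ne_top⟩)
  have hout : ∫ x, ∫ y, ∫ w, H.uncurry ((y, x) + w) ∂ν ∂μ ∂μ =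
      ((μ K₁).toReal * (μ K₂).toReal : ℂ) * ∫ z, H.uncurry z ∂(μ.prod μ) := by
    rw [← integral_prod_symm (fun z => ∫ w, H.uncurry (z + w) ∂ν) htrans.integral_prod_left,
      integral_integral_swap htrans]
    have (w : G × G) : ∫ z, H.uncurry (z + w) ∂(μ.prod μ) = ∫ z, H.uncurry z ∂(μ.prod μ) :=
      integral_add_right_eq_self H.uncurry w
    simp only [this, integral_const, hmass, Complex.real_smul, Complex.ofReal_mul]
  simp only [hinner]
  rw [hout, inv_mul_cancel_left₀ (mul_ne_zero h₁ h₂), integral_prod_symm _ hI]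
  rfl

/-- Lemma 2.3.1: for `f ∈ C_c^∞(GL₂(k); ω)` and compact open subgroups `U₁, U₂` of `(k,+)`,
the smoothed function
`f'(m) = (meas U₁ · meas U₂)⁻¹ ∫_{U₁×U₂} f(u₁ m u₂) ψ(u₁ + u₂)⁻¹ du₁ du₂`
again lies in `C_c^∞(GL₂(k); ω)`, and there is a `κ₀` (depending on `U₂`) with
`J_κ(n, f) = J_κ(n, f')` for all `κ ≥ κ₀` and all admissible `n`. -/
theorem bessel_smoothing_invariance [BorelSpace ℚ_[p]]
    (μ : Measure ℚ_[p]) [μ.IsAddHaarMeasure]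
    (ψ : ℚ_[p] → ℂ) (hψcont : Continuous ψ)
    (hψadd : ∀ x y, ψ (x + y) = ψ x * ψ y)
    (hψnorm : ∀ x, ‖ψ x‖ = 1) (hψnt : ∃ x, ψ x ≠ 1)
    (ω : ℚ_[p]ˣ → ℂ) (hωmul : ∀ s t, ω (s * t) = ω s * ω t)
    (hωlc : IsLocallyConstant ω)
    (f : GL (Fin 2) ℚ_[p] → ℂ) (hf : SmoothCptModZ p ω f)
    (U₁ U₂ : AddSubgroup ℚ_[p])
    (hU₁o : IsOpen (U₁ : Set ℚ_[p])) (hU₁c : IsCompact (U₁ : Set ℚ_[p]))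
    (hU₂o : IsOpen (U₂ : Set ℚ_[p])) (hU₂c : IsCompact (U₂ : Set ℚ_[p])) :
    letI f' : GL (Fin 2) ℚ_[p] → ℂ := fun m =>
      (((μ (U₁ : Set ℚ_[p])).toReal : ℂ) * ((μ (U₂ : Set ℚ_[p])).toReal : ℂ))⁻¹ *
        ∫ x₁ in (U₁ : Set ℚ_[p]), ∫ x₂ in (U₂ : Set ℚ_[p]),
          f (uu p x₁ * m * uu p x₂) * (ψ (x₁ + x₂))⁻¹ ∂μ ∂μ
    SmoothCptModZ p ω f' ∧
    ∃ κ₀ : ℕ, ∀ κ : ℕ, κ₀ ≤ κ → ∀ n : ℚ_[p] × ℚ_[p] × ℚ_[p], ∀ h : Adm p n,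
      Jk p μ ψ κ n h f = Jk p μ ψ κ n h f' := by
  have h₁pos : μ (U₁ : Set ℚ_[p]) ≠ 0 := hU₁o.measure_ne_zero μ ⟨0, U₁.zero_mem⟩
  have h₂pos : μ (U₂ : Set ℚ_[p]) ≠ 0 := hU₂o.measure_ne_zero μ ⟨0, U₂.zero_mem⟩
  have hψ0 (x : ℚ_[p]) : ψ x ≠ 0 := norm_ne_zero_iff.1 (by simp [hψnorm])
  have hp : (1 : ℝ) < p := by exact_mod_cast (Fact.out : p.Prime).one_lt
  refine ⟨hf.smoothing p μ (fun x₁ x₂ => (ψ (x₁ + x₂))⁻¹) _ hU₁c hU₂c hU₁o.measurableSet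
    hU₂o.measurableSet, ?_⟩
  obtain ⟨B, hB⟩ := hU₂c.exists_bound_of_continuousOn (f := id) continuousOn_id
  obtain ⟨N, hN⟩ := pow_unbounded_of_one_lt B hp
  refine ⟨max 2 N, fun κ hκ n h => ?_⟩
  have hU₂κ (x : ℚ_[p]) (hx : x ∈ U₂) : ‖x‖ ≤ (p : ℝ) ^ κ :=
    ((hB x hx).trans hN.le).trans (pow_le_pow_right₀ hp.le ((le_max_right _ _).trans hκ))
  set m := mGL p n h with hm
  set Φ : ℚ_[p] → ℂ := fun x =>
    phiK p κ (iotaM p (uu p x).val * nbarM p n * (iotaM p (uu p x).val)⁻¹) with hΦ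
  have hΦadd (x : ℚ_[p]) {t : ℚ_[p]} (ht : t ∈ U₂) : Φ (x + t) = Φ x :=
    phiK_conj_add p ((le_max_left _ _).trans hκ) (hU₂κ t ht) x _
  have hΦcont : Continuous Φ := by
    refine IsLocallyConstant.continuous ((IsLocallyConstant.iff_eventually_eq _).2 fun x => ?_)
    have hev : ∀ᶠ y in nhds x, y - x ∈ U₂ :=
      (continuous_id.sub continuous_const).continuousAt.eventually_mem
        (hU₂o.mem_nhds (by simp))
    filter_upwards [hev] with y hy
    simpa using hΦadd x hy
  set H : ℚ_[p] → ℚ_[p] → ℂ := fun y x =>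
    f (uu p y * m * uu p x) * (ψ (y + x))⁻¹ * Φ x with hH
  have hHcont : Continuous H.uncurry := by
    have hu := continuous_uu p
    have hψc : Continuous fun z : ℚ_[p] × ℚ_[p] => (ψ (z.1 + z.2))⁻¹ :=
      (hψcont.comp (continuous_fst.add continuous_snd)).inv₀ fun z => hψ0 _
    exact ((hf.1.continuous.comp (by fun_prop :
      Continuous fun z : ℚ_[p] × ℚ_[p] => uu p z.1 * m * uu p z.2)).mul hψc).mul
        (hΦcont.comp continuous_snd)
  have hHc : HasCompactSupport H.uncurry := by
    obtain ⟨R, hR⟩ := hf.bounded_section p m (by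
      simpa [hm, mGL, Matrix.GeneralLinearGroup.mkOfDetNeZero] using h.2.2.2.1)
    refine HasCompactSupport.of_support_subset_isCompact
      ((isCompact_closedBall (0 : ℚ_[p]) R).prod (isCompact_closedBall (0 : ℚ_[p]) R)) ?_
    rintro ⟨y, x⟩ hyx
    have := hR y x (left_ne_zero_of_mul (left_ne_zero_of_mul hyx))
    simpa using this
  have hleft : Jk p μ ψ κ n h f = ∫ x, ∫ y, H y x ∂μ ∂μ := by
    refine integral_congr_ae (.of_forall fun x => ?_)
    simp only [Wf, ← integral_mul_const]
    refine integral_congr_ae (.of_forall fun y => ?_)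
    simp only [hH, hΦ, hψadd, mul_inv, mul_assoc]
    ring
  rw [hleft, integral_average_translate μ hHcont hHc hU₁c hU₂c h₁pos h₂pos]
  simp only [Jk, Wf, ← integral_mul_const, ← integral_const_mul]
  refine integral_congr_ae (.of_forall fun x => integral_congr_ae (.of_forall fun y => ?_))
  refine setIntegral_congr_fun hU₁o.measurableSet fun x₁ _ =>
    setIntegral_congr_fun hU₂o.measurableSet fun x₂ hx₂ => ?_
  have hgrp : uu p x₁ * (uu p y * (m * uu p x)) * uu p x₂ =
      uu p (y + x₁) * m * uu p (x + x₂) := by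
    rw [add_comm y, uu_add, uu_add]
    simp only [mul_assoc]
  simp only [← hm, hgrp, hH, hΦadd x hx₂, hψadd, mul_inv]
  simp only [hΦ]
  ring

end
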